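/- Let k be a positive integer and suppose 2k+1 = p^e for a prime p and positive integer e. Then any sum of k (2k+1)-th roots of unity, with repetitions allowed, is nonzero; that is, for every function f : Fin k → ℂ with (f j)^(2k+1) = 1 for all j, one has ∑_{j} f j ≠ 0. -/

import Mathlib

open Polynomial in
/-- If a sum of `p ^ e`-th roots of unity in a field of characteristic zero vanishes, then the
number of summands is divisible by `p`. -/
theorem IsPrimitiveRoot.prime_dvd_card_of_sum_eq_zero {K ι : Type*} [Field K] [CharZero K]
    {p e : ℕ} (hp : p.Prime) (he : e ≠ 0) {ζ : K} (hζ : IsPrimitiveRoot ζ (p ^ e))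
    (s : Finset ι) (f : ι → K) (hf : ∀ i, f i ^ p ^ e = 1) (hsum : ∑ i ∈ s, f i = 0) :
    p ∣ s.card := by
  have hpos : 0 < p ^ e := pow_pos hp.pos e
  have : NeZero (p ^ e) := ⟨hpos.ne'⟩
  have : Fact p.Prime := ⟨hp⟩
  choose a _ ha using fun i => hζ.eq_pow_of_pow_eq_one (hf i)
  have hdvd : cyclotomic (p ^ e) ℤ ∣ ∑ i ∈ s, (X : ℤ[X]) ^ a i := by
    rw [cyclotomic_eq_minpoly hζ hpos]
    refine minpoly.isIntegrallyClosed_dvd (hζ.isIntegral hpos) ?_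
    simpa [ha] using hsum
  obtain ⟨m, rfl⟩ := Nat.exists_eq_succ_of_ne_zero he
  have hone := eval_dvd (x := 1) hdvd
  rw [Nat.succ_eq_add_one, eval_one_cyclotomic_prime_pow] at hone
  simp only [eval_finsetSum, eval_pow, eval_X, one_pow, Finset.sum_const, nsmul_eq_mul,
    mul_one] at hone
  exact_mod_cast hone

/-- Lemma 6 of the paper: if `2k+1 = p^e` is a prime power, then any sum of `k`
`(2k+1)`-th roots of unity (repetitions allowed) is nonzero. -/
theorem sum_roots_ne_zero_prime_pow (k p e : ℕ) (hk : 0 < k)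
    (hp : Nat.Prime p) (he : 0 < e) (hpe : 2 * k + 1 = p ^ e)
    (f : Fin k → ℂ) (hf : ∀ j, (f j) ^ (2 * k + 1) = 1) :
    ∑ j, f j ≠ 0 := by
  intro hsum
  rw [hpe] at hf
  have hpk : p ∣ k := by
    simpa using (Complex.isPrimitiveRoot_exp _ (pow_pos hp.pos e).ne').prime_dvd_card_of_sum_eq_zero
      hp he.ne' Finset.univ f hf hsum
  have hdvd : p ∣ 2 * k + 1 := hpe ▸ dvd_pow_self p he.ne'
  exact hp.one_lt.ne' (Nat.dvd_one.mp ((Nat.dvd_add_right (hpk.mul_left 2)).mp hdvd))
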